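/- Let a20, a11, a02, a10, a01, a00 and a20', a11', a02', a10', a01', a00' and g be smooth real functions on ℝ², and define L u = ∂_x∂_x∂_x u + a20·∂_x∂_x u + a11·∂_x∂_y u + a02·∂_y∂_y u + a10·∂_x u + a01·∂_y u + a00·u, and L' analogously with the primed coefficients. If L' u = e^{−g}·L(e^{g}·u) for every smooth u : ℝ² → ℝ, then: a11' = a11, a02' = a02, a20' = a20 + 3·∂_x g, a10' = a10 + 3·((∂_x g)² + ∂_x∂_x g) + 2·a20·∂_x g + a11·∂_y g, and a01' = a01 + a11·∂_x g + 2·a02·∂_y g. -/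

import Mathlib

noncomputable def dx (f : (Fin 2 → ℝ) → ℝ) : (Fin 2 → ℝ) → ℝ :=
  fun p => fderiv ℝ f p (Pi.single 0 1)

noncomputable def dy (f : (Fin 2 → ℝ) → ℝ) : (Fin 2 → ℝ) → ℝ :=
  fun p => fderiv ℝ f p (Pi.single 1 1)

open scoped ContDiff

section DirectionalDerivative

variable {E : Type*} [NormedAddCommGroup E] [NormedSpace ℝ E] {f g u : E → ℝ}

theorem contDiff_fderiv_apply_const (hf : ContDiff ℝ ∞ f) (v : E) :
    ContDiff ℝ ∞ (fun p => fderiv ℝ f p v) :=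
  (hf.fderiv_right (by simp)).clm_apply contDiff_const

theorem fderiv_add_mul_apply (hf : ContDiff ℝ ∞ f) (hg : ContDiff ℝ ∞ g) (hu : ContDiff ℝ ∞ u)
    (v : E) :
    (fun p => fderiv ℝ (fun y => f y + g y * u y) p v) =
      fun p => fderiv ℝ f p v + (fderiv ℝ g p v * u p + g p * fderiv ℝ u p v) := by
  funext p
  have hf' := (hf.differentiable (by simp) p).hasFDerivAt
  have hg' := (hg.differentiable (by simp) p).hasFDerivAt
  have hu' := (hu.differentiable (by simp) p).hasFDerivAt
  rw [(hf'.fun_add (hg'.fun_mul hu')).fderiv]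
  simp
  ring

theorem fderiv_exp_mul_apply (hg : ContDiff ℝ ∞ g) (hu : ContDiff ℝ ∞ u) (v : E) :
    (fun p => fderiv ℝ (fun y => Real.exp (g y) * u y) p v) =
      fun p => Real.exp (g p) * (fderiv ℝ u p v + fderiv ℝ g p v * u p) := by
  funext p
  have hg' := (hg.differentiable (by simp) p).hasFDerivAt
  have hu' := (hu.differentiable (by simp) p).hasFDerivAt
  rw [(hg'.exp.fun_mul hu').fderiv]
  simp
  ring

end DirectionalDerivative

section PartialDerivatives

variable {f g u : (Fin 2 → ℝ) → ℝ}

theorem contDiff_dx (hf : ContDiff ℝ ∞ f) : ContDiff ℝ ∞ (dx f) :=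
  contDiff_fderiv_apply_const hf _

theorem contDiff_dy (hf : ContDiff ℝ ∞ f) : ContDiff ℝ ∞ (dy f) :=
  contDiff_fderiv_apply_const hf _

theorem dx_add_mul (hf : ContDiff ℝ ∞ f) (hg : ContDiff ℝ ∞ g) (hu : ContDiff ℝ ∞ u) :
    dx (fun y => f y + g y * u y) = fun p => dx f p + (dx g p * u p + g p * dx u p) :=
  fderiv_add_mul_apply hf hg hu _

theorem dx_exp_mul (hg : ContDiff ℝ ∞ g) (hu : ContDiff ℝ ∞ u) :
    dx (fun y => Real.exp (g y) * u y) = fun p => Real.exp (g p) * (dx u p + dx g p * u p) :=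
  fderiv_exp_mul_apply hg hu _

theorem dy_add_mul (hf : ContDiff ℝ ∞ f) (hg : ContDiff ℝ ∞ g) (hu : ContDiff ℝ ∞ u) :
    dy (fun y => f y + g y * u y) = fun p => dy f p + (dy g p * u p + g p * dy u p) :=
  fderiv_add_mul_apply hf hg hu _

theorem dy_exp_mul (hg : ContDiff ℝ ∞ g) (hu : ContDiff ℝ ∞ u) :
    dy (fun y => Real.exp (g y) * u y) = fun p => Real.exp (g p) * (dy u p + dy g p * u p) :=
  fderiv_exp_mul_apply hg hu _

theorem dx_dx_exp_mul (hg : ContDiff ℝ ∞ g) (hu : ContDiff ℝ ∞ u) :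
    dx (dx (fun y => Real.exp (g y) * u y)) = fun p => Real.exp (g p) *
      (dx (dx u) p + (dx (dx g) p * u p + dx g p * dx u p)
        + dx g p * (dx u p + dx g p * u p)) := by
  rw [dx_exp_mul hg hu,
    dx_exp_mul hg ((contDiff_dx hu).add ((contDiff_dx hg).mul hu)),
    dx_add_mul (contDiff_dx hu) (contDiff_dx hg) hu]

theorem dx_dy_exp_mul (hg : ContDiff ℝ ∞ g) (hu : ContDiff ℝ ∞ u) :
    dx (dy (fun y => Real.exp (g y) * u y)) = fun p => Real.exp (g p) *
      (dx (dy u) p + (dx (dy g) p * u p + dy g p * dx u p)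
        + dx g p * (dy u p + dy g p * u p)) := by
  rw [dy_exp_mul hg hu,
    dx_exp_mul hg ((contDiff_dy hu).add ((contDiff_dy hg).mul hu)),
    dx_add_mul (contDiff_dy hu) (contDiff_dy hg) hu]

theorem dy_dy_exp_mul (hg : ContDiff ℝ ∞ g) (hu : ContDiff ℝ ∞ u) :
    dy (dy (fun y => Real.exp (g y) * u y)) = fun p => Real.exp (g p) *
      (dy (dy u) p + (dy (dy g) p * u p + dy g p * dy u p)
        + dy g p * (dy u p + dy g p * u p)) := by
  rw [dy_exp_mul hg hu,
    dy_exp_mul hg ((contDiff_dy hu).add ((contDiff_dy hg).mul hu)),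
    dy_add_mul (contDiff_dy hu) (contDiff_dy hg) hu]

theorem dx_dx_dx_exp_mul (hg : ContDiff ℝ ∞ g) (hu : ContDiff ℝ ∞ u) :
    dx (dx (dx (fun y => Real.exp (g y) * u y))) = fun p => Real.exp (g p) *
      (dx (dx (dx u)) p + 3 * dx g p * dx (dx u) p
        + 3 * ((dx g p) ^ 2 + dx (dx g) p) * dx u p
        + (dx (dx (dx g)) p + 3 * dx g p * dx (dx g) p + (dx g p) ^ 3) * u p) := by
  have hgx := contDiff_dx hg
  have hux := contDiff_dx hu
  have hw : ContDiff ℝ ∞ (fun p => dx u p + dx g p * u p) := hux.add (hgx.mul hu)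
  rw [dx_exp_mul hg hu, dx_dx_exp_mul hg hw, dx_add_mul hux hgx hu]
  have hdx : dx (fun p => dx (dx u) p + (dx (dx g) p * u p + dx g p * dx u p)) = fun p =>
      dx (dx (dx u)) p + (dx (dx (dx g)) p * u p + dx (dx g) p * dx u p)
        + (dx (dx g) p * dx u p + dx g p * dx (dx u) p) := by
    have hassoc : (fun p => dx (dx u) p + (dx (dx g) p * u p + dx g p * dx u p)) = fun p =>
        (dx (dx u) p + dx (dx g) p * u p) + dx g p * dx u p := by
      funext p; ring
    rw [hassoc, dx_add_mul ((contDiff_dx hux).add ((contDiff_dx hgx).mul hu)) hgx hux,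
      dx_add_mul (contDiff_dx hux) (contDiff_dx hgx) hu]
  rw [hdx]
  funext p
  ring

end PartialDerivatives

/-- The polynomial of degree at most two with the given coefficients, centred at `q`. -/
def quadraticAt (q : Fin 2 → ℝ) (c a b d e k : ℝ) (p : Fin 2 → ℝ) : ℝ :=
  c + a * (p 0 - q 0) + b * (p 1 - q 1) + d * (p 0 - q 0) ^ 2
    + e * ((p 0 - q 0) * (p 1 - q 1)) + k * (p 1 - q 1) ^ 2

section Quadratic

variable (q : Fin 2 → ℝ) (c a b d e k : ℝ)

@[simp]
theorem quadraticAt_self : quadraticAt q c a b d e k q = c := by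
  simp [quadraticAt]

theorem contDiff_quadraticAt : ContDiff ℝ ∞ (quadraticAt q c a b d e k) := by
  unfold quadraticAt
  fun_prop

theorem fderiv_quadraticAt_apply (p v : Fin 2 → ℝ) :
    fderiv ℝ (quadraticAt q c a b d e k) p v =
      quadraticAt q a (2 * d) e 0 0 0 p * v 0 + quadraticAt q b e (2 * k) 0 0 0 p * v 1 := by
  have h (i : Fin 2) : HasFDerivAt (fun y : Fin 2 → ℝ => y i - q i)
      (ContinuousLinearMap.proj (R := ℝ) (φ := fun _ : Fin 2 => ℝ) i) p :=
    (hasFDerivAt_apply i p).sub_const (q i)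
  have hq : HasFDerivAt (quadraticAt q c a b d e k) _ p :=
    (((((h 0).const_mul a).const_add c).fun_add ((h 1).const_mul b)).fun_add
      (((h 0).pow 2).const_mul d)).fun_add (((h 0).fun_mul (h 1)).const_mul e) |>.fun_add
      (((h 1).pow 2).const_mul k)
  rw [hq.fderiv]
  simp [quadraticAt]
  ring

@[simp]
theorem dx_quadraticAt :
    dx (quadraticAt q c a b d e k) = quadraticAt q a (2 * d) e 0 0 0 := by
  funext p
  simp [dx, fderiv_quadraticAt_apply]

@[simp]
theorem dy_quadraticAt :
    dy (quadraticAt q c a b d e k) = quadraticAt q b e (2 * k) 0 0 0 := by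
  funext p
  simp [dy, fderiv_quadraticAt_apply]

end Quadratic

theorem gauge_law_xxx
    (a20 a11 a02 a10 a01 a00 a20' a11' a02' a10' a01' a00' g : (Fin 2 → ℝ) → ℝ)
    (h20 : ContDiff ℝ (⊤ : ℕ∞) a20) (h11 : ContDiff ℝ (⊤ : ℕ∞) a11) (h02 : ContDiff ℝ (⊤ : ℕ∞) a02)
    (h10 : ContDiff ℝ (⊤ : ℕ∞) a10) (h01 : ContDiff ℝ (⊤ : ℕ∞) a01) (h00 : ContDiff ℝ (⊤ : ℕ∞) a00)
    (h20' : ContDiff ℝ (⊤ : ℕ∞) a20') (h11' : ContDiff ℝ (⊤ : ℕ∞) a11') (h02' : ContDiff ℝ (⊤ : ℕ∞) a02')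
    (h10' : ContDiff ℝ (⊤ : ℕ∞) a10') (h01' : ContDiff ℝ (⊤ : ℕ∞) a01') (h00' : ContDiff ℝ (⊤ : ℕ∞) a00')
    (hg : ContDiff ℝ (⊤ : ℕ∞) g)
    (hgauge : ∀ u : (Fin 2 → ℝ) → ℝ, ContDiff ℝ (⊤ : ℕ∞) u → ∀ x,
      dx (dx (dx u)) x + a20' x * dx (dx u) x
        + a11' x * dx (dy u) x + a02' x * dy (dy u) x
        + a10' x * dx u x + a01' x * dy u x + a00' x * u x =
      Real.exp (-(g x)) *
        (dx (dx (dx (fun y => Real.exp (g y) * u y))) x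
          + a20 x * dx (dx (fun y => Real.exp (g y) * u y)) x
          + a11 x * dx (dy (fun y => Real.exp (g y) * u y)) x
          + a02 x * dy (dy (fun y => Real.exp (g y) * u y)) x
          + a10 x * dx (fun y => Real.exp (g y) * u y) x
          + a01 x * dy (fun y => Real.exp (g y) * u y) x
          + a00 x * (Real.exp (g x) * u x))) :
    (∀ x, a11' x = a11 x) ∧
    (∀ x, a02' x = a02 x) ∧
    (∀ x, a20' x = a20 x + 3 * dx g x) ∧
    (∀ x, a10' x = a10 x + 3 * ((dx g x) ^ 2 + dx (dx g) x)
          + 2 * a20 x * dx g x + a11 x * dy g x) ∧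
    (∀ x, a01' x = a01 x + a11 x * dx g x + 2 * a02 x * dy g x) := by
  have factor (x : Fin 2 → ℝ) (A B C D E F G a b c d e f : ℝ) :
      Real.exp (-(g x)) * (Real.exp (g x) * A + a * (Real.exp (g x) * B)
        + b * (Real.exp (g x) * C) + c * (Real.exp (g x) * D) + d * (Real.exp (g x) * E)
        + e * (Real.exp (g x) * F) + f * (Real.exp (g x) * G)) =
      A + a * B + b * C + c * D + d * E + e * F + f * G := by
    have hexp : Real.exp (-(g x)) * Real.exp (g x) = 1 := by
      rw [← Real.exp_add, neg_add_cancel, Real.exp_zero]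
    linear_combination (A + a * B + b * C + c * D + d * E + e * F + f * G) * hexp
  have key (x : Fin 2 → ℝ) (c a b d e k : ℝ) := by
    have hu := contDiff_quadraticAt x c a b d e k
    have h := hgauge _ hu x
    rw [dx_dx_dx_exp_mul hg hu, dx_dx_exp_mul hg hu, dx_dy_exp_mul hg hu, dy_dy_exp_mul hg hu,
      dx_exp_mul hg hu, dy_exp_mul hg hu, factor] at h
    simp only [dx_quadraticAt, dy_quadraticAt, quadraticAt_self] at h
    exact h
  refine ⟨fun x => ?_, fun x => ?_, fun x => ?_, fun x => ?_, fun x => ?_⟩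
  · linear_combination key x 0 0 0 0 1 0
  · linear_combination key x 0 0 0 0 0 1 / 2
  · linear_combination key x 0 0 0 1 0 0 / 2
  · linear_combination key x 0 1 0 0 0 0
  · linear_combination key x 0 0 1 0 0 0
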